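/- For every real s > -3 and every δ > 0, there exists a constant C > 0 such that for all v ∈ ℝ³, ∫_{ℝ³} |v-w|^s · e^{-δ|w|²} dw ≤ C · (1+|v|²)^{s/2}. -/

import Mathlib

open MeasureTheory Real

/-- A power of `1 + r ^ 2` is dominated by a Gaussian factor. -/
lemma exists_one_add_sq_rpow_le_exp (a : ℝ) {ε : ℝ} (hε : 0 < ε) :
    ∃ M > 0, ∀ r : ℝ, (1 + r ^ 2) ^ a ≤ M * Real.exp (ε * r ^ 2) := by
  obtain ⟨n, hn⟩ := exists_nat_ge a
  refine ⟨n.factorial / ε ^ n * Real.exp ε, by positivity, fun r => ?_⟩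
  have h := Real.pow_div_factorial_le_exp (ε * (1 + r ^ 2)) (by positivity) n
  rw [div_le_iff₀ (by positivity), mul_pow] at h
  calc (1 + r ^ 2) ^ a ≤ (1 + r ^ 2) ^ (n : ℝ) :=
        Real.rpow_le_rpow_of_exponent_le (by nlinarith [sq_nonneg r]) hn
    _ = (1 + r ^ 2) ^ n := Real.rpow_natCast _ _
    _ ≤ Real.exp (ε * (1 + r ^ 2)) * n.factorial / ε ^ n := by
        rw [le_div_iff₀ (by positivity)]; linarith
    _ = _ := by rw [mul_add, mul_one, Real.exp_add]; ring

/-- Peetre's inequality for the weights `(1 + ‖v‖ ^ 2) ^ (s / 2)`. -/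
lemma one_add_norm_sq_rpow_sub_le {E : Type*} [SeminormedAddCommGroup E] (s : ℝ) (v w : E) :
    (1 + ‖v - w‖ ^ 2) ^ (s / 2) ≤
      2 ^ (|s| / 2) * (1 + ‖w‖ ^ 2) ^ (|s| / 2) * (1 + ‖v‖ ^ 2) ^ (s / 2) := by
  have key : ∀ x y z : ℝ, 0 ≤ x → x ≤ y + z → 1 + x ^ 2 ≤ 2 * (1 + z ^ 2) * (1 + y ^ 2) := by
    intro x y z hx h
    nlinarith [sq_nonneg (y - z), sq_nonneg (y * z), pow_le_pow_left₀ hx h 2]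
  rw [← Real.mul_rpow (by positivity) (by positivity)]
  rcases le_total 0 s with hs | hs
  · rw [abs_of_nonneg hs, ← Real.mul_rpow (by positivity) (by positivity)]
    exact Real.rpow_le_rpow (by positivity)
      (key _ _ _ (norm_nonneg _) (norm_sub_le v w)) (by positivity)
  · have h : 1 + ‖v‖ ^ 2 ≤ 2 * (1 + ‖w‖ ^ 2) * (1 + ‖v - w‖ ^ 2) :=
      key _ _ _ (norm_nonneg _) (by simpa using norm_add_le (v - w) w)
    have h' := Real.rpow_le_rpow_of_nonpos (by positivity) h (z := s / 2) (by linarith)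
    rw [Real.mul_rpow (by positivity) (by positivity)] at h'
    rw [abs_of_nonpos hs, neg_div, Real.rpow_neg (by positivity), ← div_eq_inv_mul,
      le_div_iff₀ (by positivity)]
    linarith

/-- Up to a term supported in the unit ball, the homogeneous weight is controlled by the
inhomogeneous one. -/
lemma norm_rpow_le_one_add_norm_sq_rpow {E : Type*} [SeminormedAddCommGroup E] (s : ℝ) (u : E) :
    ‖u‖ ^ s ≤ 2 ^ (|s| / 2) *
      (1 + (Metric.ball (0 : E) 1).indicator (fun x => ‖x‖ ^ s) u) *
        (1 + ‖u‖ ^ 2) ^ (s / 2) := by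
  have hsq : ‖u‖ ^ s = (‖u‖ ^ 2) ^ (s / 2) := by
    rw [← Real.rpow_natCast, ← Real.rpow_mul (norm_nonneg _)]
    congr 1
    push_cast
    ring
  have hind : 0 ≤ (Metric.ball (0 : E) 1).indicator (fun x => ‖x‖ ^ s) u :=
    Set.indicator_nonneg (fun x _ => by positivity) u
  rcases le_total 0 s with hs | hs
  · have h2 : (1 : ℝ) ≤ 2 ^ (|s| / 2) := Real.one_le_rpow (by norm_num) (by positivity)
    calc ‖u‖ ^ s ≤ (1 + ‖u‖ ^ 2) ^ (s / 2) := by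
          rw [hsq]
          exact Real.rpow_le_rpow (by positivity) (by linarith) (by positivity)
      _ ≤ _ := le_mul_of_one_le_left (by positivity) (by nlinarith)
  · have hs' : s / 2 ≤ 0 := by linarith
    have h2 : (2 : ℝ) ^ (|s| / 2) * 2 ^ (s / 2) = 1 := by
      rw [← Real.rpow_add (by norm_num), abs_of_nonpos hs, neg_div, neg_add_cancel, Real.rpow_zero]
    by_cases hu : ‖u‖ < 1
    · rw [Set.indicator_of_mem (by simpa using hu)]
      have h := Real.rpow_le_rpow_of_nonpos (x := 1 + ‖u‖ ^ 2) (y := 2) (by positivity)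
        (by nlinarith [norm_nonneg u]) hs'
      have h1 : 1 ≤ (2 : ℝ) ^ (|s| / 2) * (1 + ‖u‖ ^ 2) ^ (s / 2) := by
        exact h2.symm.le.trans (mul_le_mul_of_nonneg_left h (by positivity))
      have h0 : 0 ≤ ‖u‖ ^ s := by positivity
      nlinarith
    · have h := Real.rpow_le_rpow_of_nonpos (x := 1 + ‖u‖ ^ 2) (y := 2 * ‖u‖ ^ 2)
        (by positivity) (by nlinarith) hs'
      have hmem : u ∉ Metric.ball (0 : E) 1 := by simpa using hu
      rw [Set.indicator_of_notMem hmem, add_zero, mul_one]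
      rw [Real.mul_rpow (by positivity) (by positivity), ← hsq] at h
      calc ‖u‖ ^ s = 2 ^ (|s| / 2) * (2 ^ (s / 2) * ‖u‖ ^ s) := by rw [← mul_assoc, h2, one_mul]
        _ ≤ _ := by gcongr

theorem gaussian_convolution_weight_bound (s δ : ℝ) (hs : -3 < s) (hδ : 0 < δ) :
    ∃ C > 0, ∀ v : EuclideanSpace ℝ (Fin 3),
      ∫ w : EuclideanSpace ℝ (Fin 3), ‖v - w‖ ^ s * Real.exp (-δ * ‖w‖ ^ 2)
        ≤ C * (1 + ‖v‖ ^ 2) ^ (s / 2) := by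
  obtain ⟨M, hM, hMle⟩ := exists_one_add_sq_rpow_le_exp (|s| / 2) (half_pos hδ)
  set φ : EuclideanSpace ℝ (Fin 3) → ℝ :=
    (Metric.ball 0 1).indicator (fun x => ‖x‖ ^ s) with hφ
  set g : EuclideanSpace ℝ (Fin 3) → ℝ := fun w => Real.exp (-(δ / 2) * ‖w‖ ^ 2) with hg
  have hφ0 : ∀ u, 0 ≤ φ u := Set.indicator_nonneg fun x _ => by positivity
  have hφi : Integrable φ := by
    rw [hφ, integrable_indicator_iff measurableSet_ball]
    refine integrableOn_ball_of_norm_le_rpow (C := 1) (α := -s) (by simp) (by simp; linarith)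
      (ae_of_all _ fun x => ?_)
      (measurable_norm.pow_const s).aestronglyMeasurable
    rw [neg_neg, one_mul, Real.norm_of_nonneg (by positivity)]
  have hgi : Integrable g := by
    have h := GaussianFourier.integrable_cexp_neg_mul_sq_norm_add
      (V := EuclideanSpace ℝ (Fin 3)) (b := ((δ / 2 : ℝ) : ℂ)) (by simpa using hδ) 0 0
    refine h.norm.congr (ae_of_all _ fun w => ?_)
    simp [hg, Complex.norm_exp, ← Complex.ofReal_pow]
  set K : ℝ := 2 ^ (|s| / 2) * 2 ^ (|s| / 2) * M with hK
  have hK0 : 0 < K := by positivity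
  have hI : 0 ≤ (∫ w, g w) + ∫ u, φ u :=
    add_nonneg (integral_nonneg fun w => (Real.exp_pos _).le) (integral_nonneg hφ0)
  refine ⟨K * ((∫ w, g w) + (∫ u, φ u) + 1), by positivity, fun v => ?_⟩
  have hφv : Integrable fun w => φ (v - w) := hφi.comp_sub_left v
  have hpt : ∀ w, ‖v - w‖ ^ s * Real.exp (-δ * ‖w‖ ^ 2) ≤
      K * (1 + ‖v‖ ^ 2) ^ (s / 2) * (g w + φ (v - w)) := by
    intro w
    have hexp : (1 + ‖w‖ ^ 2) ^ (|s| / 2) * Real.exp (-δ * ‖w‖ ^ 2) ≤ M * g w := by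
      calc _ ≤ M * Real.exp (δ / 2 * ‖w‖ ^ 2) * Real.exp (-δ * ‖w‖ ^ 2) := by
            gcongr; exact hMle _
        _ = M * g w := by
            rw [mul_assoc, ← Real.exp_add, hg]; ring_nf
    have hg1 : g w ≤ 1 := Real.exp_le_one_iff.2 (by nlinarith [sq_nonneg ‖w‖])
    have hφw := hφ0 (v - w)
    calc ‖v - w‖ ^ s * Real.exp (-δ * ‖w‖ ^ 2)
        ≤ 2 ^ (|s| / 2) * (1 + φ (v - w)) * (2 ^ (|s| / 2) * (1 + ‖w‖ ^ 2) ^ (|s| / 2) *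
            (1 + ‖v‖ ^ 2) ^ (s / 2)) * Real.exp (-δ * ‖w‖ ^ 2) := by
          gcongr
          refine (norm_rpow_le_one_add_norm_sq_rpow s (v - w)).trans ?_
          gcongr
          exact one_add_norm_sq_rpow_sub_le s v w
      _ = 2 ^ (|s| / 2) * 2 ^ (|s| / 2) * (1 + ‖v‖ ^ 2) ^ (s / 2) * (1 + φ (v - w)) *
            ((1 + ‖w‖ ^ 2) ^ (|s| / 2) * Real.exp (-δ * ‖w‖ ^ 2)) := by ring
      _ ≤ 2 ^ (|s| / 2) * 2 ^ (|s| / 2) * (1 + ‖v‖ ^ 2) ^ (s / 2) * (1 + φ (v - w)) *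
            (M * g w) := by gcongr
      _ = K * (1 + ‖v‖ ^ 2) ^ (s / 2) * (g w + φ (v - w) * g w) := by rw [hK]; ring
      _ ≤ _ := by
          gcongr
          exact mul_le_of_le_one_right hφw hg1
  calc _ ≤ ∫ w, K * (1 + ‖v‖ ^ 2) ^ (s / 2) * (g w + φ (v - w)) :=
        integral_mono_of_nonneg (ae_of_all _ fun w => by positivity)
          ((hgi.add hφv).const_mul _) (ae_of_all _ hpt)
    _ = K * ((∫ w, g w) + ∫ u, φ u) * (1 + ‖v‖ ^ 2) ^ (s / 2) := by
        rw [integral_const_mul, integral_add hgi hφv, integral_sub_left_eq_self φ volume v]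
        ring
    _ ≤ _ := by
        gcongr ?_ * _
        exact mul_le_mul_of_nonneg_left (le_add_of_nonneg_right zero_le_one) hK0.le
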